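/- Let n ≥ 18 and let F be an intersecting family of subsets of [n] that is butterfly-free (B-free). Then |F| ≤ Σ_I(n,2). -/

import Mathlib

/-- `Σ_I(n,k)` from the paper. -/
def SigmaI (n k : ℕ) : ℕ :=
  if n % 2 = 1 then
    ∑ i ∈ Finset.Icc ((n + 1) / 2) ((n + 1) / 2 + k - 1), Nat.choose n i
  else
    Nat.choose (n - 1) (n / 2 - 1) +
      ∑ i ∈ Finset.Icc (n / 2 + 1) (n / 2 + k - 1), Nat.choose n i +
      Nat.choose (n - 1) (n / 2 + k)

/-- A family of finite sets is intersecting if any two members meet. -/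
def Intersecting {α : Type*} [DecidableEq α] (F : Finset (Finset α)) : Prop :=
  ∀ A ∈ F, ∀ B ∈ F, (A ∩ B).Nonempty

/-- A family is butterfly-free if there are no four distinct members
`A,B,C,D` with `A ⊆ C`, `A ⊆ D`, `B ⊆ C`, `B ⊆ D`. -/
def ButterflyFree {α : Type*} (F : Finset (Finset α)) : Prop :=
  ¬ ∃ A B C D : Finset α, A ∈ F ∧ B ∈ F ∧ C ∈ F ∧ D ∈ F ∧
    A ≠ B ∧ A ≠ C ∧ A ≠ D ∧ B ≠ C ∧ B ≠ D ∧ C ≠ D ∧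
    A ⊆ C ∧ A ⊆ D ∧ B ⊆ C ∧ B ⊆ D

/-- A family is `k`-Sperner if it contains no chain of `k+1` distinct sets. -/
def KSperner {α : Type*} (k : ℕ) (F : Finset (Finset α)) : Prop :=
  ¬ ∃ c : Fin (k + 1) → Finset α, (∀ i, c i ∈ F) ∧ StrictMono c

open Finset

/-- The arc of length `p.2` starting at `p.1` on the cycle `ZMod n`. -/
def arc {n : ℕ} (p : ZMod n × ℕ) : Finset (ZMod n) :=
  (range p.2).image fun i : ℕ => p.1 + (i : ZMod n)

theorem mem_arc {n : ℕ} {s x : ZMod n} {l : ℕ} :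
    x ∈ arc (s, l) ↔ ∃ i < l, s + (i : ZMod n) = x := by
  simp [arc]

theorem natCast_zmod_inj {n i j : ℕ} (hi : i < n) (hj : j < n)
    (h : (i : ZMod n) = j) : i = j := by
  rw [ZMod.natCast_eq_natCast_iff] at h
  exact Nat.ModEq.eq_of_lt_of_lt h hi hj

theorem card_arc {n : ℕ} {p : ZMod n × ℕ} (hp : p.2 ≤ n) : #(arc p) = p.2 := by
  rw [arc, card_image_of_injOn, card_range]
  intro i hi j hj h
  simp only [coe_range, Set.mem_Iio] at hi hj
  exact natCast_zmod_inj (by omega) (by omega) (add_left_cancel h)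

theorem arc_subset_arc_of_le {n l l' : ℕ} (s : ZMod n) (h : l ≤ l') :
    arc (s, l) ⊆ arc (s, l') := by
  intro x
  simp only [mem_arc]
  rintro ⟨i, hi, rfl⟩
  exact ⟨i, by omega, rfl⟩

theorem arc_add_one_subset_arc {n l l' : ℕ} (s : ZMod n) (h : l < l') :
    arc (s + 1, l) ⊆ arc (s, l') := by
  intro x
  simp only [mem_arc]
  rintro ⟨i, hi, rfl⟩
  exact ⟨i + 1, by omega, by push_cast; ring⟩

theorem disjoint_arc {n l l' : ℕ} (s : ZMod n) (h : l + l' ≤ n) :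
    Disjoint (arc (s, l)) (arc (s + l, l')) := by
  rw [Finset.disjoint_left]
  intro x
  simp only [mem_arc]
  rintro ⟨i, hi, rfl⟩ ⟨j, hj, hij⟩
  have h' : ((l + j : ℕ) : ZMod n) = (i : ℕ) := by
    push_cast
    linear_combination hij
  have := natCast_zmod_inj (by omega) (by omega) h'
  omega

theorem exists_add_of_arc_subset {n a k : ℕ} {s t : ZMod n} (ha : 1 ≤ a) (hk : k < n)
    (h : arc (s, a) ⊆ arc (t, k)) : ∃ j < k - a + 1, t + (j : ZMod n) = s := by
  have hs : s ∈ arc (t, k) := h (mem_arc.2 ⟨0, by omega, by simp⟩)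
  obtain ⟨j, hj, hjs⟩ := mem_arc.1 hs
  refine ⟨j, ?_, hjs⟩
  by_contra hlt
  have hx : t + (k : ZMod n) ∈ arc (t, k) := by
    refine h (mem_arc.2 ⟨k - j, by omega, ?_⟩)
    rw [← hjs, Nat.cast_sub hj.le]
    ring
  obtain ⟨i, hi, hik⟩ := mem_arc.1 hx
  have := natCast_zmod_inj (by omega) hk (add_left_cancel hik)
  omega

/-- The number of positions of an arc of length `a` inside arcs of length `k`. -/
theorem card_filter_arc_subset_le {n a k : ℕ} [NeZero n] (ha : 1 ≤ a) (hk : k < n) :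
    #{st : ZMod n × ZMod n | arc (st.1, a) ⊆ arc (st.2, k)} ≤ n * (k - a + 1) := by
  calc _ ≤ #(((univ : Finset (ZMod n)) ×ˢ range (k - a + 1)).image
          fun tj => (tj.1 + (tj.2 : ZMod n), tj.1)) := by
        refine card_le_card fun ⟨s, t⟩ hst => ?_
        obtain ⟨j, hj, rfl⟩ := exists_add_of_arc_subset ha hk (by simpa using hst)
        exact mem_image.2 ⟨(t, j), by simpa using hj, rfl⟩
    _ ≤ #((univ : Finset (ZMod n)) ×ˢ range (k - a + 1)) := card_image_le
    _ = _ := by simp [ZMod.card]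

/-- A nonempty proper subset of the cycle grows when its translate by a generator is added. -/
theorem card_lt_card_union_image_add {n : ℕ} [NeZero n] {S : Finset (ZMod n)} {c : ZMod n}
    (hc : ∀ x, ∃ i : ℕ, i • c = x) (hS : S.Nonempty) (hn : #S < n) :
    #S < #(S ∪ S.image (· + c)) := by
  by_contra! hle
  have heq : S = S ∪ S.image (· + c) := eq_of_subset_of_card_le subset_union_left hle
  have hstep : ∀ s ∈ S, s + c ∈ S := fun s hs => by
    rw [heq]
    exact mem_union_right _ (mem_image_of_mem _ hs)
  obtain ⟨s, hs⟩ := hS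
  have hall : ∀ i : ℕ, s + i • c ∈ S := fun i => by
    induction i with
    | zero => simpa using hs
    | succ i ih =>
      rw [succ_nsmul, ← add_assoc]
      exact hstep _ ih
  have : S = univ := eq_univ_of_forall fun t => by
    obtain ⟨i, hi⟩ := hc (t - s)
    simpa [hi] using hall i
  rw [this, card_univ, ZMod.card] at hn
  exact lt_irrefl _ hn

theorem exists_nsmul_one_eq {n : ℕ} [NeZero n] (x : ZMod n) : ∃ i : ℕ, i • (1 : ZMod n) = x :=
  ⟨x.val, by simp⟩

theorem exists_nsmul_neg_one_eq {n : ℕ} [NeZero n] (x : ZMod n) :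
    ∃ i : ℕ, i • (-1 : ZMod n) = x :=
  ⟨(-x).val, by simp⟩

/-- No arc of the family is contained in a longer one. -/
def ArcAntichain {n : ℕ} (Y : Finset (ZMod n × ℕ)) : Prop :=
  ∀ p ∈ Y, ∀ q ∈ Y, p.2 < q.2 → ¬ arc p ⊆ arc q

/-- The family consists of proper nonempty arcs, any two of which meet. -/
def ArcIntersecting {n : ℕ} (Z : Finset (ZMod n × ℕ)) : Prop :=
  (∀ p ∈ Z, 1 ≤ p.2 ∧ p.2 < n) ∧ ∀ p ∈ Z, ∀ q ∈ Z, ¬ Disjoint (arc p) (arc q)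

theorem ArcAntichain.injOn_fst {n : ℕ} {Y : Finset (ZMod n × ℕ)} (hY : ArcAntichain Y) :
    Set.InjOn Prod.fst (Y : Set (ZMod n × ℕ)) := by
  rintro ⟨s, l⟩ hp ⟨t, k⟩ hq (rfl : s = t)
  rcases lt_trichotomy l k with h | h | h
  · exact (hY _ hp _ hq h (arc_subset_arc_of_le s h.le)).elim
  · rw [h]
  · exact (hY _ hq _ hp h (arc_subset_arc_of_le s h.le)).elim

theorem ArcAntichain.mono {n : ℕ} {Y Y' : Finset (ZMod n × ℕ)} (hY : ArcAntichain Y)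
    (h : Y' ⊆ Y) : ArcAntichain Y' :=
  fun p hp q hq => hY p (h hp) q (h hq)

theorem ArcAntichain.card_le {n : ℕ} [NeZero n] {Y : Finset (ZMod n × ℕ)}
    (hY : ArcAntichain Y) : #Y ≤ n := by
  rw [← card_image_of_injOn hY.injOn_fst]
  exact (card_le_univ _).trans_eq (ZMod.card n)

/-- An antichain of `n` arcs consists of all arcs of one length. -/
theorem ArcAntichain.eq_of_card_eq {n : ℕ} [NeZero n] {Y : Finset (ZMod n × ℕ)}
    (hY : ArcAntichain Y) (hc : #Y = n) : ∃ l, Y = univ.image fun s => (s, l) := by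
  have himg : Y.image Prod.fst = univ := by
    refine eq_univ_of_card _ ?_
    rw [card_image_of_injOn hY.injOn_fst, hc, ZMod.card]
  have hex : ∀ s : ZMod n, ∃ l, (s, l) ∈ Y := fun s => by
    have := himg ▸ mem_univ s
    obtain ⟨⟨_, l⟩, hp, rfl⟩ := mem_image.1 this
    exact ⟨l, hp⟩
  choose l hl using hex
  have hstep : ∀ s, l s ≤ l (s + 1) := fun s => by
    by_contra! h
    exact hY _ (hl (s + 1)) _ (hl s) h (arc_add_one_subset_arc s h)
  have hle : ∀ s t, l s ≤ l t := fun s t => by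
    have : ∀ i : ℕ, l s ≤ l (s + i) := fun i => by
      induction i with
      | zero => simp
      | succ i ih => simpa [add_assoc] using ih.trans (hstep _)
    simpa using this (t - s).val
  refine ⟨l 0, (eq_of_subset_of_card_le (fun p hp => ?_) ?_).symm⟩
  · obtain ⟨s, -, rfl⟩ := mem_image.1 hp
    rw [le_antisymm (hle 0 s) (hle s 0)]
    exact hl s
  · rw [card_image_of_injective _ (fun s t h => (Prod.mk.inj h).1), card_univ, ZMod.card, hc]

/-- At most half of the arcs of length `m` on a cycle of length `2 * m`, even after
extending shorter arcs, belong to an intersecting antichain. -/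
theorem ArcIntersecting.card_le_of_antichain {m : ℕ} [NeZero (2 * m)]
    {L : Finset (ZMod (2 * m) × ℕ)} (hI : ArcIntersecting L) (hA : ArcAntichain L)
    (hL : ∀ p ∈ L, p.2 ≤ m) : #L ≤ m := by
  set S := L.image Prod.fst with hS
  have hcard : #S = #L := card_image_of_injOn hA.injOn_fst
  have hdisj : Disjoint S (S.image (· + (m : ZMod (2 * m)))) := by
    rw [Finset.disjoint_left]
    intro t ht ht'
    obtain ⟨s, hs, rfl⟩ := mem_image.1 ht'
    obtain ⟨⟨s, l⟩, hp, rfl⟩ := mem_image.1 hs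
    obtain ⟨⟨t, k⟩, hq, rfl : t = s + m⟩ := mem_image.1 ht
    refine hI.2 _ hp _ hq ?_
    exact (disjoint_arc s (l := m) (l' := m) (by omega)).mono
      (arc_subset_arc_of_le _ (hL _ hp)) (arc_subset_arc_of_le _ (hL _ hq))
  have := card_union_of_disjoint hdisj
  rw [card_image_of_injective _ (add_left_injective _), hcard] at this
  have h2 := card_le_univ (S ∪ S.image (· + (m : ZMod (2 * m))))
  rw [ZMod.card] at h2
  omega

/-- Of each pair of complementary arcs at most one belongs to an intersecting family. -/
theorem ArcIntersecting.card_filter_add_card_filter_le {n a b : ℕ} [NeZero n] (hab : a + b = n)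
    {Z : Finset (ZMod n × ℕ)} (hI : ArcIntersecting Z) :
    #{p ∈ Z | p.2 = a} + #{p ∈ Z | p.2 = b} ≤ n := by
  have hinj : ∀ c : ℕ, Set.InjOn Prod.fst (({p ∈ Z | p.2 = c} : Finset _) : Set (ZMod n × ℕ)) := by
    rintro c ⟨s, l⟩ hp ⟨t, k⟩ hq (rfl : s = t)
    simp only [coe_filter, Set.mem_ofPred_eq] at hp hq
    rw [hp.2, hq.2]
  have hinj' : Set.InjOn (fun p : ZMod n × ℕ => p.1 + (a : ZMod n))
      (({p ∈ Z | p.2 = a} : Finset _) : Set (ZMod n × ℕ)) :=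
    fun p hp q hq h => hinj a hp hq (add_right_cancel h)
  rw [← card_image_of_injOn hinj', ← card_image_of_injOn (hinj b), ← card_union_of_disjoint]
  · exact (card_le_univ _).trans_eq (ZMod.card n)
  rw [Finset.disjoint_left]
  intro t ht ht'
  obtain ⟨⟨s, l⟩, hp, rfl⟩ := mem_image.1 ht
  obtain ⟨⟨t, k⟩, hq, rfl : t = s + a⟩ := mem_image.1 ht'
  simp only [mem_filter] at hp hq
  obtain ⟨hp, rfl⟩ := hp
  obtain ⟨hq, rfl⟩ := hq
  exact hI.2 _ hp _ hq (disjoint_arc s (by omega))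
/-- The surplus weight, in units of one half, given to members lying in two antichains. -/
def excess (n l : ℕ) : ℕ := if n ≤ 2 * l + 2 ∧ 2 * l ≤ n + 2 then 1 else 2

theorem choose_le_choose_of_le_half {n i j : ℕ} (hij : i ≤ j) (hj : 2 * j ≤ n + 1) :
    n.choose i ≤ n.choose j := by
  induction j, hij using Nat.le_induction with
  | base => rfl
  | succ j _ ih =>
    refine (ih (by omega)).trans ?_
    have h := Nat.choose_succ_right_eq n j
    refine Nat.le_of_mul_le_mul_right ?_ (Nat.succ_pos j)
    rw [Nat.succ_eq_add_one, h]
    exact Nat.mul_le_mul_left _ (by omega)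

theorem choose_le_choose_of_half_le {n i j : ℕ} (hij : i ≤ j) (hi : n ≤ 2 * i + 1) :
    n.choose j ≤ n.choose i := by
  rcases lt_or_ge n j with h | h
  · simp [Nat.choose_eq_zero_of_lt h]
  rw [← Nat.choose_symm h, ← Nat.choose_symm (hij.trans h)]
  exact choose_le_choose_of_le_half (by omega) (by omega)

theorem two_mul_sum_add_sum_le {ι : Type*} [DecidableEq ι] {Y₁ Y₂ : Finset ι} {f e : ι → ℕ}
    {P Q : ι → Prop} [DecidablePred P] [DecidablePred Q] {a b c : ℕ}
    (hf : ∀ p ∈ Y₁ ∪ Y₂, f p ≤ a + (if P p then b else 0) + if Q p then c else 0)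
    (he : ∀ p ∈ Y₁ ∩ Y₂, e p * f p ≤ 2 * a) :
    2 * ∑ p ∈ Y₁ ∪ Y₂, f p + ∑ p ∈ Y₁ ∩ Y₂, e p * f p ≤
      2 * a * (#Y₁ + #Y₂) + 2 * b * #{p ∈ Y₁ ∪ Y₂ | P p} + 2 * c * #{p ∈ Y₁ ∪ Y₂ | Q p} := by
  have h1 := sum_le_sum hf
  rw [sum_add_distrib, sum_add_distrib, sum_const, smul_eq_mul, ← sum_filter, ← sum_filter,
    sum_const, sum_const, smul_eq_mul, smul_eq_mul] at h1
  have h2 := sum_le_sum he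
  rw [sum_const, smul_eq_mul] at h2
  rw [← card_union_add_card_inter]
  linarith

/-- The weighted cycle inequality for an odd number `2 * k + 1` of points. -/
theorem cycle_sum_le_of_odd {k : ℕ} (hk : 9 ≤ k) {Y₁ Y₂ : Finset (ZMod (2 * k + 1) × ℕ)}
    (h₁ : ArcAntichain Y₁) (h₂ : ArcAntichain Y₂) (hI : ArcIntersecting (Y₁ ∪ Y₂)) :
    2 * ∑ p ∈ Y₁ ∪ Y₂, (2 * k + 1).choose p.2 +
        ∑ p ∈ Y₁ ∩ Y₂, excess (2 * k + 1) p.2 * (2 * k + 1).choose p.2 ≤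
      2 * ((2 * k + 1) * ((2 * k + 1).choose (k + 1) + (2 * k + 1).choose (k + 2))) := by
  have hr : (2 * k + 1).choose (k + 2) * (k + 2) = (2 * k + 1).choose (k + 1) * k := by
    rw [Nat.choose_succ_right_eq]
    congr 1
    omega
  have hs : (2 * k + 1).choose k = (2 * k + 1).choose (k + 1) :=
    Nat.choose_symm_of_eq_add (by omega)
  have hs' : (2 * k + 1).choose (k - 1) = (2 * k + 1).choose (k + 2) :=
    Nat.choose_symm_of_eq_add (by omega)
  set c₀ := (2 * k + 1).choose (k + 1) with hc₀
  set c₁ := (2 * k + 1).choose (k + 2) with hc₁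
  have hle : c₁ ≤ c₀ := choose_le_choose_of_half_le (by omega) (by omega)
  have hle2 : c₀ ≤ 2 * c₁ := by nlinarith
  have hoff : ∀ l, l ≠ k → l ≠ k + 1 → (2 * k + 1).choose l ≤ c₁ := fun l h h' => by
    rcases lt_or_ge l k with hl | hl
    · rw [← hs']
      exact choose_le_choose_of_le_half (by omega) (by omega)
    · exact choose_le_choose_of_half_le (by omega) (by omega)
  have key := two_mul_sum_add_sum_le (Y₁ := Y₁) (Y₂ := Y₂)
    (f := fun p => (2 * k + 1).choose p.2) (e := fun p => excess (2 * k + 1) p.2)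
    (P := fun p => p.2 = k) (Q := fun p => p.2 = k + 1) (a := c₁) (b := c₀ - c₁) (c := c₀ - c₁)
    (fun p _ => by
      by_cases h : p.2 = k
      · simp [h, hs]; omega
      by_cases h' : p.2 = k + 1
      · simp [h', ← hc₀]; omega
      simpa [h, h'] using hoff _ h h')
    (fun p _ => by
      dsimp only [excess]
      split_ifs with h
      · have : (2 * k + 1).choose p.2 = c₀ := by
          obtain h | h : p.2 = k ∨ p.2 = k + 1 := by omega
          all_goals rw [h]
          exact hs
        omega
      · have := hoff p.2 (by omega) (by omega)
        omega)
  have hU := hI.card_filter_add_card_filter_le (a := k) (b := k + 1) (by omega)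
  have hN := Nat.add_le_add h₁.card_le h₂.card_le
  refine key.trans ?_
  obtain ⟨d, hd⟩ := Nat.exists_eq_add_of_le hle
  rw [hd, Nat.add_sub_cancel_left]
  nlinarith [Nat.mul_le_mul_left c₁ hN, Nat.mul_le_mul_left d hU]

/-- The bound when one of the antichains is the full level `m + 1` and the other one is `Y`. -/
theorem card_bound_of_full_level {m : ℕ} [NeZero (2 * m)] {Y : Finset (ZMod (2 * m) × ℕ)}
    (hY : ArcAntichain Y) (hI : ArcIntersecting Y) :
    #{p ∈ Y | p.2 ≤ m} ≤ m ∧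
    #{p ∈ Y | p.2 ≤ m} + #{p ∈ Y | p.2 = m + 1} + #{p ∈ Y | m + 2 ≤ p.2} ≤ 2 * m ∧
    (#{p ∈ Y | p.2 ≤ m} ≠ 0 →
      #{p ∈ Y | p.2 ≤ m} + #{p ∈ Y | p.2 = m + 1} + 1 ≤ 2 * m ∧
      (#{p ∈ Y | m + 2 ≤ p.2} ≠ 0 →
        #{p ∈ Y | p.2 ≤ m} + #{p ∈ Y | p.2 = m + 1} + #{p ∈ Y | m + 2 ≤ p.2} + 2 ≤ 2 * m)) := by
  set L := {p ∈ Y | p.2 ≤ m} with hL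
  set T := {p ∈ Y | p.2 = m + 1} with hT
  set H := {p ∈ Y | m + 2 ≤ p.2} with hH
  have hm : 0 < 2 * m := Nat.pos_of_ne_zero (NeZero.ne _)
  have hLm : #L ≤ m := by
    refine ArcIntersecting.card_le_of_antichain ⟨fun p hp => hI.1 p (filter_subset _ _ hp),
      fun p hp q hq => hI.2 p (filter_subset _ _ hp) q (filter_subset _ _ hq)⟩
      (hY.mono (filter_subset _ _)) fun p hp => (mem_filter.1 hp).2
  have hsum : #L + #T + #H = #Y := by
    rw [← card_union_of_disjoint, ← card_union_of_disjoint]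
    · congr 1
      ext p
      simp only [hL, hT, hH, mem_union, mem_filter, ← and_or_left, and_iff_left_iff_imp]
      omega
    all_goals
      rw [Finset.disjoint_left]
      intro p
      simp only [hL, hT, hH, mem_union, mem_filter]
      omega
  have hYc := hY.card_le
  have hcardS : ∀ Z ⊆ Y, #(Z.image Prod.fst) = #Z := fun Z hZ =>
    card_image_of_injOn (hY.mono hZ).injOn_fst
  set NL := L.image Prod.fst ∪ (L.image Prod.fst).image (· + (-1)) with hNL
  set NH := H.image Prod.fst ∪ (H.image Prod.fst).image (· + 1) with hNH
  have hup : ∀ x ∈ NL, ∃ p ∈ Y, p.2 ≤ m ∧ arc p ⊆ arc (x, m + 1) := fun x hx => by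
    rcases mem_union.1 hx with hx | hx
    · obtain ⟨⟨s, l⟩, hp, rfl⟩ := mem_image.1 hx
      obtain ⟨hp, hpm⟩ := mem_filter.1 hp
      exact ⟨_, hp, hpm, arc_subset_arc_of_le _ (Nat.le_succ_of_le hpm)⟩
    · obtain ⟨y, hy, rfl⟩ := mem_image.1 hx
      obtain ⟨⟨s, l⟩, hp, rfl⟩ := mem_image.1 hy
      obtain ⟨hp, hpm⟩ := mem_filter.1 hp
      refine ⟨_, hp, hpm, ?_⟩
      have := arc_add_one_subset_arc (s + -1) (Nat.lt_succ_of_le hpm)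
      rwa [neg_add_cancel_right] at this
  have hdown : ∀ x ∈ NH, ∃ p ∈ Y, m + 2 ≤ p.2 ∧ arc (x, m + 1) ⊆ arc p := fun x hx => by
    rcases mem_union.1 hx with hx | hx
    · obtain ⟨⟨s, l⟩, hp, rfl⟩ := mem_image.1 hx
      obtain ⟨hp, hpm⟩ := mem_filter.1 hp
      exact ⟨_, hp, hpm, arc_subset_arc_of_le _ (by omega)⟩
    · obtain ⟨y, hy, rfl⟩ := mem_image.1 hx
      obtain ⟨⟨s, l⟩, hp, rfl⟩ := mem_image.1 hy
      obtain ⟨hp, hpm⟩ := mem_filter.1 hp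
      exact ⟨_, hp, hpm, arc_add_one_subset_arc s hpm⟩
  have hLT : Disjoint NL (T.image Prod.fst) := by
    rw [Finset.disjoint_left]
    intro x hx hx'
    obtain ⟨p, hp, hpm, hpx⟩ := hup x hx
    obtain ⟨⟨_, l⟩, hq, rfl⟩ := mem_image.1 hx'
    obtain ⟨hq, rfl : l = m + 1⟩ := mem_filter.1 hq
    exact hY _ hp _ hq (Nat.lt_succ_of_le hpm) hpx
  have hLH : Disjoint (NL ∪ T.image Prod.fst) NH := by
    rw [Finset.disjoint_left]
    intro x hx hx'
    obtain ⟨q, hq, hqm, hqx⟩ := hdown x hx'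
    rcases mem_union.1 hx with hx | hx
    · obtain ⟨p, hp, hpm, hpx⟩ := hup x hx
      exact hY _ hp _ hq (by omega) (hpx.trans hqx)
    · obtain ⟨⟨_, l⟩, hp, rfl⟩ := mem_image.1 hx
      obtain ⟨hp, rfl : l = m + 1⟩ := mem_filter.1 hp
      exact hY _ hp _ hq hqm hqx
  have htot : #NL + #(T.image Prod.fst) + #NH ≤ 2 * m := by
    rw [← card_union_of_disjoint hLT, ← card_union_of_disjoint hLH]
    exact (card_le_univ _).trans_eq (ZMod.card _)
  rw [hcardS T (filter_subset _ _)] at htot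
  refine ⟨hLm, by omega, fun hL0 => ?_⟩
  have hLlt : #L < #NL := by
    rw [← hcardS L (filter_subset _ _)]
    refine card_lt_card_union_image_add exists_nsmul_neg_one_eq ?_ ?_
    · exact (card_ne_zero.1 hL0).image _
    · rw [hcardS L (filter_subset _ _)]
      omega
  refine ⟨by omega, fun hH0 => ?_⟩
  have hHlt : #H < #NH := by
    rw [← hcardS H (filter_subset _ _)]
    refine card_lt_card_union_image_add exists_nsmul_one_eq ?_ ?_
    · exact (card_ne_zero.1 hH0).image _
    · rw [hcardS H (filter_subset _ _)]
      omega
  omega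

/-- The weighted cycle inequality for `2 * m` points when one antichain is the level `m + 1`. -/
theorem cycle_sum_le_of_full_level {m : ℕ} (hm : 9 ≤ m) {Y₁ Y₂ : Finset (ZMod (2 * m) × ℕ)}
    (h₁ : ArcAntichain Y₁) (hI : ArcIntersecting (Y₁ ∪ Y₂))
    (hfull : Y₂ = (letI : NeZero (2 * m) := ⟨by omega⟩; univ.image fun s => (s, m + 1))) :
    2 * ∑ p ∈ Y₁ ∪ Y₂, (2 * m).choose p.2 +
        ∑ p ∈ Y₁ ∩ Y₂, excess (2 * m) p.2 * (2 * m).choose p.2 ≤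
      2 * (m * (2 * m).choose m + 2 * m * (2 * m).choose (m + 1) +
        (m - 2) * (2 * m).choose (m + 2)) := by
  have : NeZero (2 * m) := ⟨by omega⟩
  have hr₁ : (2 * m).choose (m + 1) * (m + 1) = (2 * m).choose m * m := by
    rw [Nat.choose_succ_right_eq]
    congr 1
    omega
  have hr₂ : (2 * m).choose (m + 2) * (m + 2) = (2 * m).choose (m + 1) * (m - 1) := by
    rw [Nat.choose_succ_right_eq]
    congr 1
    omega
  obtain ⟨hLm, hall, hL⟩ := card_bound_of_full_level h₁
    ⟨fun p hp => hI.1 p (mem_union_left _ hp),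
      fun p hp q hq => hI.2 p (mem_union_left _ hp) q (mem_union_left _ hq)⟩
  have hunion : Y₁ ∪ Y₂ = {p ∈ Y₁ | p.2 ≤ m} ∪ ({p ∈ Y₁ | m + 2 ≤ p.2} ∪ Y₂) := by
    ext ⟨s, l⟩
    simp only [hfull, mem_union, mem_filter, mem_image, mem_univ, true_and, Prod.mk.injEq,
      exists_eq_left]
    by_cases h : (s, l) ∈ Y₁ <;> simp only [h, true_or, true_and, false_and, false_or, true_iff]
    omega
  have hinter : Y₁ ∩ Y₂ = {p ∈ Y₁ | p.2 = m + 1} := by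
    ext ⟨s, l⟩
    simp [hfull, eq_comm]
  have hsum₂ : ∑ p ∈ Y₂, (2 * m).choose p.2 = 2 * m * (2 * m).choose (m + 1) := by
    rw [hfull, sum_image fun s _ t _ h => (Prod.mk.inj h).1]
    simp [ZMod.card]
  have hsumL : ∑ p ∈ Y₁ with p.2 ≤ m, (2 * m).choose p.2 ≤
      #{p ∈ Y₁ | p.2 ≤ m} * (2 * m).choose m :=
    sum_le_card_nsmul _ _ _ fun p hp =>
      choose_le_choose_of_le_half (mem_filter.1 hp).2 (by omega)
  have hsumH : ∑ p ∈ Y₁ with m + 2 ≤ p.2, (2 * m).choose p.2 ≤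
      #{p ∈ Y₁ | m + 2 ≤ p.2} * (2 * m).choose (m + 2) :=
    sum_le_card_nsmul _ _ _ fun p hp =>
      choose_le_choose_of_half_le (mem_filter.1 hp).2 (by omega)
  have hsumT : ∑ p ∈ Y₁ ∩ Y₂, excess (2 * m) p.2 * (2 * m).choose p.2 ≤
      #{p ∈ Y₁ | p.2 = m + 1} * (2 * m).choose (m + 1) := by
    rw [hinter]
    refine sum_le_card_nsmul _ _ _ fun p hp => ?_
    rw [(mem_filter.1 hp).2, excess, if_pos (by omega), one_mul]
  have hsumU : ∑ p ∈ Y₁ ∪ Y₂, (2 * m).choose p.2 ≤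
      #{p ∈ Y₁ | p.2 ≤ m} * (2 * m).choose m + (#{p ∈ Y₁ | m + 2 ≤ p.2} * (2 * m).choose (m + 2)
        + 2 * m * (2 * m).choose (m + 1)) := by
    rw [hunion, ← hsum₂]
    have hLHY := sum_union_inter (s₁ := {p ∈ Y₁ | p.2 ≤ m}) (s₂ := {p ∈ Y₁ | m + 2 ≤ p.2} ∪ Y₂)
      (f := fun p => (2 * m).choose p.2)
    have hHY := sum_union_inter (s₁ := {p ∈ Y₁ | m + 2 ≤ p.2}) (s₂ := Y₂)
      (f := fun p => (2 * m).choose p.2)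
    omega
  refine (Nat.add_le_add (Nat.mul_le_mul_left 2 hsumU) hsumT).trans ?_
  have hc₂ : (2 * m).choose (m + 2) ≤ (2 * m).choose (m + 1) :=
    choose_le_choose_of_half_le (by omega) (by omega)
  have hc₀ : (2 * m).choose (m + 1) ≤ (2 * m).choose m :=
    choose_le_choose_of_half_le (by omega) (by omega)
  generalize #{p ∈ Y₁ | p.2 ≤ m} = u at *
  generalize #{p ∈ Y₁ | p.2 = m + 1} = t at *
  generalize #{p ∈ Y₁ | m + 2 ≤ p.2} = h at *
  generalize (2 * m).choose m = c₀ at *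
  generalize (2 * m).choose (m + 1) = c₁ at *
  generalize (2 * m).choose (m + 2) = c₂ at *
  obtain ⟨r, hmr⟩ := Nat.exists_eq_add_of_le (show 2 ≤ m by omega)
  have e1 : m - 1 = r + 1 := by omega
  have e2 : m - 2 = r := by omega
  rw [e1] at hr₂
  rw [e2]
  clear hI hfull h₁ hunion hinter hsum₂ hsumL hsumH hsumT hsumU
  subst hmr
  have hr : 7 ≤ r := by omega
  have hc₁ : c₁ ≤ 2 * c₂ := by
    have := Nat.mul_le_mul_left c₂ (show r + 4 ≤ 2 * (r + 1) by omega)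
    exact Nat.le_of_mul_le_mul_right (by linarith) (Nat.succ_pos r)
  have htc := Nat.mul_le_mul_left t hc₁
  by_cases hu : u = 0
  · subst hu
    have := Nat.mul_le_mul_left c₂ hall
    have := Nat.mul_le_mul_left (r + 1) hc₀
    linarith
  obtain ⟨hLT, hLH⟩ := hL hu
  obtain ⟨d, hd⟩ := Nat.exists_eq_add_of_le hLm
  have hdu : (2 + r) * c₀ = u * c₀ + d * c₀ := by rw [hd, add_mul]
  have hdc := Nat.mul_le_mul_left d hc₀
  by_cases hh : h = 0
  · subst hh
    have := Nat.mul_le_mul_left c₁ (show t ≤ r + 1 + d by omega)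
    have := Nat.mul_le_mul_left c₂ (show r + 4 ≤ 2 * r by omega)
    have := Nat.zero_le (d * c₀)
    linarith
  · have := hLH hh
    have := Nat.mul_le_mul_left c₂ (show t + h ≤ r + d by omega)
    have := Nat.mul_le_mul_left d hc₂
    linarith

/-- The weighted cycle inequality for an even number `2 * m` of points. -/
theorem cycle_sum_le_of_even {m : ℕ} (hm : 9 ≤ m) {Y₁ Y₂ : Finset (ZMod (2 * m) × ℕ)}
    (h₁ : ArcAntichain Y₁) (h₂ : ArcAntichain Y₂) (hI : ArcIntersecting (Y₁ ∪ Y₂)) :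
    2 * ∑ p ∈ Y₁ ∪ Y₂, (2 * m).choose p.2 +
        ∑ p ∈ Y₁ ∩ Y₂, excess (2 * m) p.2 * (2 * m).choose p.2 ≤
      2 * (m * (2 * m).choose m + 2 * m * (2 * m).choose (m + 1) +
        (m - 2) * (2 * m).choose (m + 2)) := by
  have : NeZero (2 * m) := ⟨by omega⟩
  have hlevel : ∀ l, Y₁ = univ.image (fun s => (s, l)) ∨ Y₂ = univ.image (fun s => (s, l)) →
      m < l := fun l hl => by
    by_contra! hlm
    have hmem : ∀ s, (s, l) ∈ Y₁ ∪ Y₂ := fun s => by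
      rcases hl with hl | hl <;> simp [hl]
    exact hI.2 _ (hmem 0) _ (hmem (0 + l)) (disjoint_arc 0 (by omega))
  by_cases hfull₂ : Y₂ = univ.image fun s => (s, m + 1)
  · exact cycle_sum_le_of_full_level hm h₁ hI hfull₂
  by_cases hfull₁ : Y₁ = univ.image fun s => (s, m + 1)
  · rw [union_comm, inter_comm]
    exact cycle_sum_le_of_full_level hm h₂ (union_comm Y₁ Y₂ ▸ hI) hfull₁
  have hr₁ : (2 * m).choose (m + 1) * (m + 1) = (2 * m).choose m * m := by
    rw [Nat.choose_succ_right_eq]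
    congr 1
    omega
  have hr₂ : (2 * m).choose (m + 2) * (m + 2) = (2 * m).choose (m + 1) * (m - 1) := by
    rw [Nat.choose_succ_right_eq]
    congr 1
    omega
  have hs₁ : (2 * m).choose (m - 1) = (2 * m).choose (m + 1) :=
    Nat.choose_symm_of_eq_add (by omega)
  have hs₂ : (2 * m).choose (m - 2) = (2 * m).choose (m + 2) :=
    Nat.choose_symm_of_eq_add (by omega)
  have hoff : ∀ l, l ≠ m → ¬ (l = m - 1 ∨ l = m + 1) →
      (2 * m).choose l ≤ (2 * m).choose (m + 2) := fun l h h' => by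
    rcases lt_or_ge l m with hl | hl
    · rw [← hs₂]
      exact choose_le_choose_of_le_half (by omega) (by omega)
    · exact choose_le_choose_of_half_le (by omega) (by omega)
  obtain ⟨r, hmr⟩ := Nat.exists_eq_add_of_le (show 2 ≤ m by omega)
  have e1 : m - 1 = r + 1 := by omega
  have e2 : m - 2 = r := by omega
  have hc₂ : (2 * m).choose (m + 2) ≤ (2 * m).choose (m + 1) :=
    choose_le_choose_of_half_le (by omega) (by omega)
  have hc₁ : (2 * m).choose (m + 1) ≤ (2 * m).choose m :=
    choose_le_choose_of_half_le (by omega) (by omega)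
  have hc₀ : (2 * m).choose m ≤ 2 * (2 * m).choose (m + 2) := by
    rw [e1] at hr₂
    generalize (2 * m).choose m = c₀ at *
    generalize (2 * m).choose (m + 1) = c₁ at *
    generalize (2 * m).choose (m + 2) = c₂ at *
    have h7 : c₂ * ((m + 2) * (m + 1)) = c₀ * (m * (r + 1)) := by
      linear_combination (m + 1) * hr₂ + (r + 1) * hr₁
    have h8 : (m + 2) * (m + 1) ≤ 2 * (m * (r + 1)) := by
      subst hmr
      nlinarith
    have h9 : 0 < (m + 2) * (m + 1) := by positivity
    refine Nat.le_of_mul_le_mul_right ?_ h9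
    calc c₀ * ((m + 2) * (m + 1)) ≤ c₀ * (2 * (m * (r + 1))) := Nat.mul_le_mul_left _ h8
      _ = 2 * c₂ * ((m + 2) * (m + 1)) := by linarith
  have key := two_mul_sum_add_sum_le (Y₁ := Y₁) (Y₂ := Y₂)
    (f := fun p => (2 * m).choose p.2) (e := fun p => excess (2 * m) p.2)
    (P := fun p => p.2 = m) (Q := fun p => p.2 = m - 1 ∨ p.2 = m + 1)
    (a := (2 * m).choose (m + 2)) (b := (2 * m).choose m - (2 * m).choose (m + 2))
    (c := (2 * m).choose (m + 1) - (2 * m).choose (m + 2))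
    (fun p _ => by
      by_cases h : p.2 = m
      · simp only [h, if_true]
        omega
      by_cases h' : p.2 = m - 1 ∨ p.2 = m + 1
      · have : (2 * m).choose p.2 = (2 * m).choose (m + 1) := by
          rcases h' with h' | h' <;> rw [h']
          exact hs₁
        simp only [h', h, this, if_true, if_false]
        omega
      simpa [h, h'] using hoff _ h h')
    (fun p _ => by
      dsimp only [excess]
      split_ifs with h
      · have : (2 * m).choose p.2 ≤ (2 * m).choose m :=
          Nat.choose_le_centralBinom _ _
        omega
      · have := hoff p.2 (by omega) (by omega)
        omega)
  have hU := hI.card_filter_add_card_filter_le (a := m) (b := m) (by omega)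
  have hV : #{p ∈ Y₁ ∪ Y₂ | p.2 = m - 1 ∨ p.2 = m + 1} ≤ 2 * m := by
    rw [filter_or]
    exact (card_union_le _ _).trans
      (hI.card_filter_add_card_filter_le (by omega))
  have hN₁ := h₁.card_le
  have hN₂ := h₂.card_le
  have hcase : #Y₁ + #Y₂ + 2 ≤ 4 * m ∨
      #{p ∈ Y₁ ∪ Y₂ | p.2 = m} + #{p ∈ Y₁ ∪ Y₂ | p.2 = m - 1 ∨ p.2 = m + 1} ≤ 2 * m := by
    by_contra! hcon
    have hlow : ∀ Y Y' : Finset (ZMod (2 * m) × ℕ), #Y ≤ 2 * m → ∀ l, m + 1 < l →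
        Y' = univ.image (fun s => (s, l)) →
        #{p ∈ Y ∪ Y' | p.2 = m} + #{p ∈ Y ∪ Y' | p.2 = m - 1 ∨ p.2 = m + 1} ≤ 2 * m := by
      intro Y Y' hY l hl hY'
      rw [← card_union_of_disjoint]
      · refine (card_le_card fun p hp => ?_).trans hY
        rw [← filter_or, mem_filter, mem_union] at hp
        rcases hp with ⟨hp | hp, hpm⟩
        · exact hp
        · rw [hY'] at hp
          obtain ⟨s, -, rfl⟩ := mem_image.1 hp
          dsimp only at hpm
          omega
      · rw [Finset.disjoint_left]
        intro p
        simp only [mem_filter]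
        omega
    obtain h | h : #Y₁ = 2 * m ∨ #Y₂ = 2 * m := by omega
    · obtain ⟨l, hl⟩ := h₁.eq_of_card_eq h
      have hne : l ≠ m + 1 := fun h' => hfull₁ (h' ▸ hl)
      have hlt := hlevel l (Or.inl hl)
      have := hlow Y₂ Y₁ hN₂ l (by omega) hl
      rw [union_comm] at this
      omega
    · obtain ⟨l, hl⟩ := h₂.eq_of_card_eq h
      have hne : l ≠ m + 1 := fun h' => hfull₂ (h' ▸ hl)
      have hlt := hlevel l (Or.inr hl)
      have := hlow Y₁ Y₂ hN₁ l (by omega) hl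
      omega
  refine key.trans ?_
  obtain ⟨d, hd⟩ := Nat.exists_eq_add_of_le hc₂
  obtain ⟨d', hd'⟩ := Nat.exists_eq_add_of_le (hc₂.trans hc₁)
  rw [e1, hd] at hr₂
  rw [e2, hd, hd', Nat.add_sub_cancel_left, Nat.add_sub_cancel_left]
  generalize #{p ∈ Y₁ ∪ Y₂ | p.2 = m} = u at *
  generalize #{p ∈ Y₁ ∪ Y₂ | p.2 = m - 1 ∨ p.2 = m + 1} = v at *
  generalize (2 * m).choose (m + 2) = c₂ at *
  have hdd : d ≤ d' := by omega
  have hum : u ≤ m := by omega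
  clear key hoff hlevel
  rcases hcase with hcase | hcase
  · have := Nat.mul_le_mul_left c₂ hcase
    have := Nat.mul_le_mul_left d' hum
    have := Nat.mul_le_mul_left d hV
    subst hmr
    linarith
  · have hmd : 2 * c₂ ≤ m * d := by
      subst hmr
      nlinarith
    have := Nat.mul_le_mul_left d hcase
    have := Nat.mul_le_mul_left c₂ (Nat.add_le_add hN₁ hN₂)
    obtain ⟨f, rfl⟩ := Nat.exists_eq_add_of_le hdd
    have := Nat.mul_le_mul_left f hum
    subst hmr
    linarith

theorem map_equiv_eq_iff {α β : Type*} {S : Finset α} {A : Finset β} (σ : α ≃ β) :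
    S.map σ.toEmbedding = A ↔ ∀ a, σ a ∈ A ↔ a ∈ S := by
  refine ⟨?_, fun h => ?_⟩
  · rintro rfl a
    simp
  · ext b
    obtain ⟨a, rfl⟩ := σ.surjective b
    simp [h]

open scoped Nat in
/-- The number of bijections carrying a nested pair of sets to a given nested pair of sets. -/
theorem card_filter_map_eq_and_map_eq {α β : Type*} [Fintype α] [DecidableEq α] [Fintype β]
    [DecidableEq β] {S₁ S₂ : Finset α} (hS : S₁ ⊆ S₂) (σ₀ : α ≃ β) :
    #{σ : α ≃ β | S₁.map σ.toEmbedding = S₁.map σ₀.toEmbedding ∧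
        S₂.map σ.toEmbedding = S₂.map σ₀.toEmbedding} =
      (#S₁)! * (#S₂ - #S₁)! * (Fintype.card α - #S₂)! := by
  let f : α → Fin 3 := fun a => if a ∈ S₁ then 0 else if a ∈ S₂ then 1 else 2
  have hf : ∀ a b, f a = f b ↔ (a ∈ S₁ ↔ b ∈ S₁) ∧ (a ∈ S₂ ↔ b ∈ S₂) := fun a b => by
    have ha := @hS a
    have hb := @hS b
    simp only [f]
    split_ifs <;> simp_all
  have h0 : Fintype.card {a // f a = 0} = #S₁ := by
    rw [Fintype.card_subtype]
    congr 1
    ext a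
    simp only [f, mem_filter, mem_univ, true_and]
    split_ifs <;> simp_all
  have h1 : Fintype.card {a // f a = 1} = #S₂ - #S₁ := by
    rw [Fintype.card_subtype, ← card_sdiff_of_subset hS]
    congr 1
    ext a
    simp only [f, mem_filter, mem_univ, true_and, mem_sdiff]
    split_ifs <;> simp_all
  have h2 : Fintype.card {a // f a = 2} = Fintype.card α - #S₂ := by
    rw [Fintype.card_subtype, ← card_compl]
    congr 1
    ext a
    have ha := @hS a
    simp only [f, mem_filter, mem_univ, true_and, mem_compl]
    split_ifs <;> simp_all
  rw [← h1, ← h0, ← h2, ← Fin.prod_univ_three fun i : Fin 3 => (Fintype.card {a // f a = i})!,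
    ← DomMulAct.stabilizer_card, ← Fintype.card_subtype]
  refine Fintype.card_congr (Equiv.subtypeEquiv (Equiv.equivCongr (Equiv.refl α) σ₀.symm) ?_)
  intro σ
  rw [funext_iff, map_equiv_eq_iff, map_equiv_eq_iff, ← forall_and]
  refine forall_congr' fun a => ?_
  simp only [Function.comp_apply, hf]
  simp

open scoped Nat in
theorem card_filter_map_eq_and_map_eq_le {α β : Type*} [Fintype α] [DecidableEq α] [Fintype β]
    [DecidableEq β] {S₁ S₂ : Finset α} {A M : Finset β} (hA : A ⊆ M) :
    #{σ : α ≃ β | S₁.map σ.toEmbedding = A ∧ S₂.map σ.toEmbedding = M} ≤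
      (#A)! * (#M - #A)! * (Fintype.card α - #M)! := by
  rcases (filter (fun σ : α ≃ β => S₁.map σ.toEmbedding = A ∧ S₂.map σ.toEmbedding = M)
    univ).eq_empty_or_nonempty with h | ⟨σ₀, h⟩
  · simp [h]
  · obtain ⟨rfl, rfl⟩ := (mem_filter.1 h).2
    rw [card_filter_map_eq_and_map_eq (map_subset_map.1 hA), card_map, card_map]

open scoped Nat in
theorem card_filter_map_eq {α β : Type*} [Fintype α] [DecidableEq α] [Fintype β]
    [DecidableEq β] {S : Finset α} {A : Finset β} (h : Fintype.card α = Fintype.card β)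
    (hc : #S = #A) :
    #{σ : α ≃ β | S.map σ.toEmbedding = A} = (#A)! * (Fintype.card β - #A)! := by
  obtain ⟨σ₀, rfl⟩ : ∃ σ₀ : α ≃ β, S.map σ₀.toEmbedding = A := by
    let e : S ≃ A := Finset.equivOfCardEq hc
    let e' : {x // ¬ x ∈ S} ≃ {x // ¬ x ∈ A} := Fintype.equivOfCardEq (by
      rw [Fintype.card_subtype_compl, Fintype.card_subtype_compl, h]
      simp [hc])
    refine ⟨(Equiv.sumCompl _).symm.trans ((Equiv.sumCongr e e').trans (Equiv.sumCompl _)), ?_⟩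
    rw [map_equiv_eq_iff]
    intro a
    by_cases ha : a ∈ S
    · simp [ha, Equiv.sumCompl_symm_apply_of_pos]
    · simpa [ha, Equiv.sumCompl_symm_apply_of_neg] using (e' ⟨a, ha⟩).2
  simpa [h] using card_filter_map_eq_and_map_eq (Subset.refl S) σ₀

/-- All proper nonempty arcs, given by starting point and length. -/
def properArcs (n : ℕ) [NeZero n] : Finset (ZMod n × ℕ) := univ ×ˢ Ico 1 n

theorem mem_properArcs {n : ℕ} [NeZero n] {p : ZMod n × ℕ} :
    p ∈ properArcs n ↔ 1 ≤ p.2 ∧ p.2 < n := by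
  simp [properArcs]

open scoped Nat in
theorem sum_sum_map_arc_eq {n : ℕ} [NeZero n] {G : Finset (Finset (Fin n))}
    (hG : ∀ M ∈ G, 1 ≤ #M ∧ #M < n) (w : ℕ → ℕ) :
    ∑ σ : ZMod n ≃ Fin n, ∑ p ∈ properArcs n with (arc p).map σ.toEmbedding ∈ G,
        w p.2 * n.choose p.2 = n * n ! * ∑ M ∈ G, w #M := by
  have h1 : ∀ (σ : ZMod n ≃ Fin n) (p : ZMod n × ℕ),
      (if (arc p).map σ.toEmbedding ∈ G then w p.2 * n.choose p.2 else 0) =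
        ∑ M ∈ G, if (arc p).map σ.toEmbedding = M then w p.2 * n.choose p.2 else 0 := by
    intro σ p
    rw [sum_ite_eq]
  have h2 : ∀ M ∈ G, ∀ p ∈ properArcs n,
      (∑ σ : ZMod n ≃ Fin n, if (arc p).map σ.toEmbedding = M then w p.2 * n.choose p.2 else 0) =
        if p.2 = #M then n ! * w #M else 0 := by
    intro M hM p hp
    have hp' := mem_properArcs.1 hp
    rw [← sum_filter, sum_const, smul_eq_mul]
    split_ifs with h
    · rw [card_filter_map_eq (by simp [ZMod.card]) (by rw [card_arc hp'.2.le, h]), Fintype.card_fin,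
        h, ← Nat.choose_mul_factorial_mul_factorial (hG M hM).2.le]
      ring
    · rw [filter_false_of_mem, card_empty, zero_mul]
      rintro σ - rfl
      rw [card_map, card_arc hp'.2.le] at h
      exact h rfl
  simp_rw [sum_filter, h1]
  rw [sum_congr rfl fun σ _ => sum_comm, sum_comm, mul_sum]
  refine sum_congr rfl fun M hM => ?_
  rw [sum_comm, sum_congr rfl (h2 M hM), properArcs, sum_product]
  simp only [sum_ite_eq', if_pos (mem_Ico.2 (hG M hM)), sum_const, card_univ, ZMod.card, smul_eq_mul,
    mul_assoc]

/-- The number of pairs of arcs that a labelling of the cycle carries to `A` and `M`. -/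
def arcPairCount {n : ℕ} [NeZero n] (A M : Finset (Fin n)) (σ : ZMod n ≃ Fin n) : ℕ :=
  #{pq ∈ properArcs n ×ˢ properArcs n |
    (arc pq.1).map σ.toEmbedding = A ∧ (arc pq.2).map σ.toEmbedding = M}

open scoped Nat in
theorem sum_arcPairCount_le {n : ℕ} [NeZero n] {A M : Finset (Fin n)} (hAM : A ⊆ M)
    (hA : 1 ≤ #A) (hM : #M < n) :
    ∑ σ : ZMod n ≃ Fin n, arcPairCount A M σ ≤
      n * (#M - #A + 1) * ((#A)! * (#M - #A)! * (n - #M)!) := by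
  simp_rw [arcPairCount, card_filter]
  rw [sum_comm]
  simp_rw [← card_filter]
  have h1 : ∀ pq ∈ properArcs n ×ˢ properArcs n, #{σ : ZMod n ≃ Fin n |
      (arc pq.1).map σ.toEmbedding = A ∧ (arc pq.2).map σ.toEmbedding = M} ≤
      if (pq.1.2 = #A ∧ pq.2.2 = #M) ∧ arc pq.1 ⊆ arc pq.2 then
        (#A)! * (#M - #A)! * (n - #M)! else 0 := by
    intro pq hpq
    rw [mem_product, mem_properArcs, mem_properArcs] at hpq
    split_ifs with h
    · simpa [ZMod.card] using card_filter_map_eq_and_map_eq_le (α := ZMod n) hAM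
    · rw [Nat.le_zero, card_eq_zero, filter_eq_empty_iff]
      rintro σ - ⟨rfl, rfl⟩
      rw [card_map, card_map, card_arc hpq.1.2.le, card_arc hpq.2.2.le] at h
      exact h ⟨⟨rfl, rfl⟩, map_subset_map.1 hAM⟩
  refine (sum_le_sum h1).trans ?_
  rw [← sum_filter, sum_const, smul_eq_mul]
  refine Nat.mul_le_mul_right _ (le_trans ?_ (card_filter_arc_subset_le (n := n) hA hM))
  refine card_le_card_of_injOn (fun pq => (pq.1.1, pq.2.1)) ?_ ?_
  · rintro ⟨⟨s, l⟩, t, k⟩ h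
    simp only [coe_filter, Set.mem_ofPred_eq] at h
    obtain ⟨-, ⟨rfl, rfl⟩, h⟩ := h
    simpa using h
  · rintro ⟨⟨s, l⟩, t, k⟩ h ⟨⟨s', l'⟩, t', k'⟩ h' heq
    simp only [coe_filter, Set.mem_ofPred_eq] at h h'
    simp_all

theorem succ_mul_le_two_mul_choose {N d : ℕ} (hd : 1 ≤ d) (hN : d + 2 ≤ N) :
    (d + 1) * N ≤ 2 * N.choose d := by
  obtain ⟨e, rfl⟩ := Nat.exists_eq_add_of_le' hd
  obtain ⟨N, rfl⟩ := Nat.exists_eq_add_of_le' (show 1 ≤ N by omega)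
  have h1 := Nat.add_one_mul_choose_eq N e
  have h2 : (e + 1 + 1).choose e ≤ N.choose e := Nat.choose_le_choose e (by omega)
  have h3 : (e + 1 + 1).choose e * 2 = (e + 1 + 1) * (e + 1) := by
    rw [← Nat.choose_symm (by omega), show e + 1 + 1 - e = 2 by omega, Nat.choose_two_right,
      Nat.div_mul_cancel (Nat.even_mul_pred_self _).two_dvd]
    simp
  have h4 := Nat.mul_le_mul_left (N + 1) (Nat.mul_le_mul_right 2 h2)
  refine Nat.le_of_mul_le_mul_right ?_ (Nat.succ_pos e)
  rw [Nat.succ_eq_add_one]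
  rw [h3] at h4
  linarith

open scoped Nat in
theorem choose_mul_sum_arcPairCount_le {n : ℕ} [NeZero n] {A M : Finset (Fin n)}
    (hAM : A ⊂ M) (hA : 1 ≤ #A) (hM : #M + 2 ≤ n) :
    (n.choose #A * ∑ σ : ZMod n ≃ Fin n, arcPairCount A M σ) * (n - #M + 1) ≤
      2 * (n * n !) := by
  have hlt := card_lt_card hAM
  obtain ⟨d, hd⟩ := Nat.exists_eq_add_of_le hlt.le
  have h1 := sum_arcPairCount_le hAM.subset hA (by omega)
  have h2 := Nat.choose_mul_factorial_mul_factorial (show #A ≤ n by omega)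
  have h3 := Nat.choose_mul_factorial_mul_factorial (show d ≤ n - #A by omega)
  have h4 := succ_mul_le_two_mul_choose (show 1 ≤ d by omega) (show d + 2 ≤ n - #A by omega)
  rw [show #M - #A = d by omega] at h1
  rw [show n - #A - d = n - #M by omega] at h3
  calc _ ≤ (n.choose #A * (n * (d + 1) * ((#A)! * d ! * (n - #M)!))) * (n - #A) := by
        gcongr
        omega
    _ = n * (n.choose #A * (#A)! * (d ! * (n - #M)! * ((d + 1) * (n - #A)))) := by ring
    _ ≤ n * (n.choose #A * (#A)! * (d ! * (n - #M)! * (2 * (n - #A).choose d))) := by gcongr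
    _ = 2 * n * (n.choose #A * (#A)! * ((n - #A).choose d * d ! * (n - #M)!)) := by ring
    _ = _ := by rw [h3, h2, mul_assoc]

open scoped Nat in
theorem choose_mul_sum_arcPairCount_le_of_lt {n : ℕ} [NeZero n] {M C : Finset (Fin n)}
    (hMC : M ⊂ C) (hM : 2 ≤ #M) (hC : #C < n) :
    (n.choose #C * ∑ σ : ZMod n ≃ Fin n, arcPairCount M C σ) * (#M + 1) ≤
      2 * (n * n !) := by
  have hlt := card_lt_card hMC
  obtain ⟨d, hd⟩ := Nat.exists_eq_add_of_le hlt.le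
  have h1 := sum_arcPairCount_le hMC.subset (by omega) (by omega)
  have h2 := Nat.choose_mul_factorial_mul_factorial (show #C ≤ n by omega)
  have h3 := Nat.choose_mul_factorial_mul_factorial (show d ≤ #C by omega)
  have h4 := succ_mul_le_two_mul_choose (show 1 ≤ d by omega) (show d + 2 ≤ #C by omega)
  rw [show #C - #M = d by omega] at h1
  rw [show #C - d = #M by omega] at h3
  calc _ ≤ (n.choose #C * (n * (d + 1) * ((#M)! * d ! * (n - #C)!))) * #C := by
        gcongr
        omega
    _ = n * (n.choose #C * (n - #C)! * (d ! * (#M)! * ((d + 1) * #C))) := by ring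
    _ ≤ n * (n.choose #C * (n - #C)! * (d ! * (#M)! * (2 * (#C).choose d))) := by gcongr
    _ = 2 * n * (n.choose #C * ((#C).choose d * d ! * (#M)!) * (n - #C)!) := by ring
    _ = _ := by rw [h3, h2, mul_assoc]

theorem sum_arcPairCount_eq {n : ℕ} [NeZero n] (σ : ZMod n ≃ Fin n)
    (t : Finset (Finset (Fin n) × Finset (Fin n))) (w : ℕ → ℕ → ℕ) :
    ∑ pq ∈ properArcs n ×ˢ properArcs n with
        ((arc pq.1).map σ.toEmbedding, (arc pq.2).map σ.toEmbedding) ∈ t, w pq.1.2 pq.2.2 =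
      ∑ AM ∈ t, w #AM.1 #AM.2 * arcPairCount AM.1 AM.2 σ := by
  set g : (ZMod n × ℕ) × (ZMod n × ℕ) → Finset (Fin n) × Finset (Fin n) := fun pq =>
    ((arc pq.1).map σ.toEmbedding, (arc pq.2).map σ.toEmbedding) with hg
  have h : ∀ pq ∈ {pq ∈ properArcs n ×ˢ properArcs n | g pq ∈ t}, g pq ∈ t :=
    fun pq hpq => (mem_filter.1 hpq).2
  rw [← sum_fiberwise_of_maps_to h]
  refine sum_congr rfl fun AM hAM => ?_
  rw [arcPairCount, mul_comm, ← smul_eq_mul, ← sum_const, filter_filter]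
  refine sum_congr ?_ fun pq hpq => ?_
  · ext pq
    simp only [hg, mem_filter, Prod.ext_iff]
    refine and_congr_right fun _ => ⟨fun h => h.2, fun h => ⟨?_, h⟩⟩
    rwa [h.1, h.2]
  · obtain ⟨h, h1, h2⟩ := mem_filter.1 hpq
    rw [mem_product, mem_properArcs, mem_properArcs] at h
    rw [← h1, ← h2, card_map, card_map, card_arc h.1.2.le, card_arc h.2.2.le]

/-- The members of `F` that are neither minimal nor maximal. -/
def middle {α : Type*} [DecidableEq α] (F : Finset (Finset α)) : Finset (Finset α) :=
  {M ∈ F | (∃ A ∈ F, A ⊂ M) ∧ ∃ C ∈ F, M ⊂ C}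

theorem mem_middle {α : Type*} [DecidableEq α] {F : Finset (Finset α)} {M : Finset α} :
    M ∈ middle F ↔ M ∈ F ∧ (∃ A ∈ F, A ⊂ M) ∧ ∃ C ∈ F, M ⊂ C := by
  simp [middle]

theorem ButterflyFree.false_of_ssubset {α : Type*} {F : Finset (Finset α)} (hB : ButterflyFree F)
    {A B C D : Finset α} (hA : A ∈ F) (hB' : B ∈ F) (hC : C ∈ F) (hD : D ∈ F) (hAB : A ≠ B)
    (hCD : C ≠ D) (hAC : A ⊂ C) (hAD : A ⊂ D) (hBC : B ⊂ C) (hBD : B ⊂ D) : False :=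
  hB ⟨A, B, C, D, hA, hB', hC, hD, hAB, hAC.ne, hAD.ne, hBC.ne, hBD.ne, hCD, hAC.subset,
    hAD.subset, hBC.subset, hBD.subset⟩

theorem ButterflyFree.not_ssubset_of_mem_middle {α : Type*} [DecidableEq α]
    {F : Finset (Finset α)} (hB : ButterflyFree F) {M N : Finset α} (hM : M ∈ middle F)
    (hN : N ∈ middle F) : ¬ M ⊂ N := by
  intro h
  obtain ⟨hM, ⟨A, hA, hAM⟩, -⟩ := mem_middle.1 hM
  obtain ⟨hN, -, C, hC, hNC⟩ := mem_middle.1 hN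
  exact hB.false_of_ssubset hA hM hN hC hAM.ne hNC.ne (hAM.trans h) (hAM.trans (h.trans hNC)) h
    (h.trans hNC)

theorem ButterflyFree.exists_filter_ssubset_eq {α : Type*} [DecidableEq α]
    {F : Finset (Finset α)} (hB : ButterflyFree F) {M : Finset α} (hM : M ∈ middle F) :
    ∃ A ∈ F, A ⊂ M ∧ {B ∈ F | B ⊂ M} = {A} := by
  obtain ⟨hM, ⟨A, hA, hAM⟩, C, hC, hMC⟩ := mem_middle.1 hM
  refine ⟨A, hA, hAM, eq_singleton_iff_unique_mem.2 ⟨mem_filter.2 ⟨hA, hAM⟩, fun B hBM => ?_⟩⟩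
  obtain ⟨hB', hBM⟩ := mem_filter.1 hBM
  by_contra h
  exact hB.false_of_ssubset hB' hA hM hC h hMC.ne hBM (hBM.trans hMC) hAM (hAM.trans hMC)

theorem ButterflyFree.exists_filter_superset_eq {α : Type*} [DecidableEq α]
    {F : Finset (Finset α)} (hB : ButterflyFree F) {M : Finset α} (hM : M ∈ middle F) :
    ∃ C ∈ F, M ⊂ C ∧ {D ∈ F | M ⊂ D} = {C} := by
  obtain ⟨hM, ⟨A, hA, hAM⟩, C, hC, hMC⟩ := mem_middle.1 hM
  refine ⟨C, hC, hMC, eq_singleton_iff_unique_mem.2 ⟨mem_filter.2 ⟨hC, hMC⟩, fun D hDM => ?_⟩⟩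
  obtain ⟨hD, hMD⟩ := mem_filter.1 hDM
  by_contra h
  exact hB.false_of_ssubset hA hM hD hC hAM.ne h (hAM.trans hMD) (hAM.trans hMC) hMD hMC

/-- `K` bounds the total weight of any two antichains of arcs whose union is intersecting. -/
def CycleBound (n K : ℕ) : Prop :=
  ∀ Y₁ Y₂ : Finset (ZMod n × ℕ), ArcAntichain Y₁ → ArcAntichain Y₂ → ArcIntersecting (Y₁ ∪ Y₂) →
    2 * ∑ p ∈ Y₁ ∪ Y₂, n.choose p.2 + ∑ p ∈ Y₁ ∩ Y₂, excess n p.2 * n.choose p.2 ≤ K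

theorem ssubset_map_of_arc_subset {n : ℕ} {p q : ZMod n × ℕ} (σ : ZMod n ≃ Fin n)
    (hq : q.2 < n) (hpq : p.2 < q.2) (h : arc p ⊆ arc q) :
    (arc p).map σ.toEmbedding ⊂ (arc q).map σ.toEmbedding := by
  refine map_ssubset_map.2 (ssubset_of_subset_of_ne h fun he => ?_)
  have := card_arc hq.le
  rw [← he, card_arc (by omega)] at this
  omega

theorem sum_union_le_add {ι : Type*} [DecidableEq ι] (s t : Finset ι) (f : ι → ℕ) :
    ∑ i ∈ s ∪ t, f i ≤ ∑ i ∈ s, f i + ∑ i ∈ t, f i :=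
  (Nat.le_add_right _ _).trans_eq sum_union_inter

theorem CycleBound.sum_choose_le {n K : ℕ} [NeZero n] (hK : CycleBound n K)
    {F : Finset (Finset (Fin n))} (hF : Intersecting F) (hB : ButterflyFree F)
    (σ : ZMod n ≃ Fin n) :
    2 * ∑ p ∈ properArcs n with (arc p).map σ.toEmbedding ∈ F, n.choose p.2 +
        ∑ p ∈ properArcs n with (arc p).map σ.toEmbedding ∈ middle F,
          excess n p.2 * n.choose p.2 ≤
      K + 2 * (∑ M ∈ middle F, ∑ A ∈ F with A ⊂ M, n.choose #A * arcPairCount A M σ +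
        ∑ M ∈ middle F, ∑ C ∈ F with M ⊂ C, n.choose #C * arcPairCount M C σ) := by
  set g : ZMod n × ℕ → Finset (Fin n) := fun p => (arc p).map σ.toEmbedding with hg
  have hmid : ∀ {M}, M ∈ middle F → M ∈ F := fun h => (mem_middle.1 h).1
  set Y₁ := {p ∈ properArcs n | g p ∈ middle F ∨ (g p ∈ F ∧ (∀ A ∈ F, ¬ A ⊂ g p) ∧
    ∀ q ∈ properArcs n, g q ∈ middle F → ¬ g p ⊂ g q)} with hY₁
  set Y₂ := {p ∈ properArcs n | g p ∈ middle F ∨ (g p ∈ F ∧ (∃ A ∈ F, A ⊂ g p) ∧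
    (∀ C ∈ F, ¬ g p ⊂ C) ∧ ∀ q ∈ properArcs n, g q ∈ middle F → ¬ g q ⊂ g p)} with hY₂
  have hYF : ∀ p ∈ Y₁ ∪ Y₂, p ∈ properArcs n ∧ g p ∈ F := fun p hp => by
    simp only [hY₁, hY₂, mem_union, mem_filter] at hp
    rcases hp with ⟨h, h' | h'⟩ | ⟨h, h' | h'⟩
    exacts [⟨h, hmid h'⟩, ⟨h, h'.1⟩, ⟨h, hmid h'⟩, ⟨h, h'.1⟩]
  have hss : ∀ p q, q ∈ properArcs n → p.2 < q.2 → arc p ⊆ arc q → g p ⊂ g q := fun p q hq =>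
    ssubset_map_of_arc_subset σ (mem_properArcs.1 hq).2
  have hA₁ : ArcAntichain Y₁ := fun p hp q hq hpq hsub => by
    have hpF := (hYF p (mem_union_left _ hp)).2
    obtain ⟨-, hp⟩ := mem_filter.1 hp
    obtain ⟨hqI, hq⟩ := mem_filter.1 hq
    have hlt := hss p q hqI hpq hsub
    rcases hq with hq | hq
    · rcases hp with hp | hp
      · exact hB.not_ssubset_of_mem_middle hp hq hlt
      · exact hp.2.2 q hqI hq hlt
    · exact hq.2.1 _ hpF hlt
  have hA₂ : ArcAntichain Y₂ := fun p hp q hq hpq hsub => by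
    have hqF := hYF q (mem_union_right _ hq)
    obtain ⟨hpI, hp⟩ := mem_filter.1 hp
    obtain ⟨-, hq⟩ := mem_filter.1 hq
    have hlt := hss p q hqF.1 hpq hsub
    rcases hp with hp | hp
    · rcases hq with hq | hq
      · exact hB.not_ssubset_of_mem_middle hp hq hlt
      · exact hq.2.2.2 p hpI hp hlt
    · exact hp.2.2.1 _ hqF.2 hlt
  have hI : ArcIntersecting (Y₁ ∪ Y₂) := by
    refine ⟨fun p hp => mem_properArcs.1 (hYF p hp).1, fun p hp q hq hdis => ?_⟩
    have := hF _ (hYF p hp).2 _ (hYF q hq).2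
    rw [hg, ← map_inter, disjoint_iff_inter_eq_empty.1 hdis] at this
    simp at this
  have hinter : Y₁ ∩ Y₂ = {p ∈ properArcs n | g p ∈ middle F} := by
    ext p
    simp only [hY₁, hY₂, mem_inter, mem_filter]
    constructor
    · rintro ⟨⟨h, h1 | h1⟩, -, h2 | h2⟩
      · exact ⟨h, h1⟩
      · exact ⟨h, h1⟩
      · exact ⟨h, h2⟩
      · obtain ⟨A, hA, hlt⟩ := h2.2.1
        exact (h1.2.1 A hA hlt).elim
    · exact fun h => ⟨⟨h.1, Or.inl h.2⟩, h.1, Or.inl h.2⟩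
  set t₁ := {AM ∈ F ×ˢ middle F | AM.1 ⊂ AM.2} with ht₁
  set t₂ := {MC ∈ middle F ×ˢ F | MC.1 ⊂ MC.2} with ht₂
  set T₁ := {pq ∈ properArcs n ×ˢ properArcs n | (g pq.1, g pq.2) ∈ t₁} with hT₁
  set T₂ := {pq ∈ properArcs n ×ˢ properArcs n | (g pq.1, g pq.2) ∈ t₂} with hT₂
  have hcover : {p ∈ properArcs n | g p ∈ F} ⊆
      (Y₁ ∪ Y₂) ∪ (T₁.image Prod.fst ∪ T₂.image Prod.snd) := by
    intro p hp
    obtain ⟨hpI, hpF⟩ := mem_filter.1 hp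
    by_contra hnot
    simp only [hY₁, hY₂, hT₁, hT₂, ht₁, ht₂, mem_union, mem_filter, mem_image, mem_product,
      Prod.exists, exists_and_right, exists_eq_right, not_or, not_and, not_exists] at hnot
    obtain ⟨⟨h1, h2⟩, h3, h4⟩ := hnot
    have hpm := (h1 hpI).1
    by_cases hlow : ∃ A ∈ F, A ⊂ g p
    · have hhigh : ∀ C ∈ F, ¬ g p ⊂ C := fun C hC hlt =>
        hpm (mem_middle.2 ⟨hpF, hlow, C, hC, hlt⟩)
      refine (h2 hpI).2 hpF hlow hhigh fun q hq hqm hlt => ?_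
      exact h4 q.1 q.2 ⟨hq, hpI⟩ ⟨hqm, hpF⟩ hlt
    · push Not at hlow
      refine (h1 hpI).2 hpF hlow fun q hq hqm hlt => ?_
      exact h3 q.1 q.2 ⟨hpI, hq⟩ ⟨hpF, hqm⟩ hlt
  have hsum₁ : ∑ pq ∈ T₁, n.choose pq.1.2 =
      ∑ M ∈ middle F, ∑ A ∈ F with A ⊂ M, n.choose #A * arcPairCount A M σ := by
    rw [hT₁, sum_arcPairCount_eq σ t₁ fun a _ => n.choose a, ht₁, sum_filter, sum_product_right]
    exact sum_congr rfl fun M _ => (sum_filter _ _).symm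
  have hsum₂ : ∑ pq ∈ T₂, n.choose pq.2.2 =
      ∑ M ∈ middle F, ∑ C ∈ F with M ⊂ C, n.choose #C * arcPairCount M C σ := by
    rw [hT₂, sum_arcPairCount_eq σ t₂ fun _ c => n.choose c, ht₂, sum_filter, sum_product]
    exact sum_congr rfl fun M _ => (sum_filter _ _).symm
  have hle : ∑ p ∈ properArcs n with g p ∈ F, n.choose p.2 ≤
      ∑ p ∈ Y₁ ∪ Y₂, n.choose p.2 +
        (∑ pq ∈ T₁, n.choose pq.1.2 + ∑ pq ∈ T₂, n.choose pq.2.2) := by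
    refine (sum_le_sum_of_subset hcover).trans ?_
    refine (sum_union_le_add _ _ _).trans (Nat.add_le_add_left ?_ _)
    refine (sum_union_le_add _ _ _).trans (Nat.add_le_add ?_ ?_)
    · exact sum_image_le_of_nonneg (fun _ _ => Nat.zero_le _)
    · exact sum_image_le_of_nonneg (fun _ _ => Nat.zero_le _)
  have := hK Y₁ Y₂ hA₁ hA₂ hI
  rw [hinter] at this
  rw [← hsum₁, ← hsum₂]
  linarith

theorem two_mul_add_le_excess_mul {n k T x y : ℕ} (hn : 18 ≤ n) (hk : 2 ≤ k) (hkn : k + 2 ≤ n)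
    (hx : x * (n - k + 1) ≤ 2 * T) (hy : y * (k + 1) ≤ 2 * T) :
    2 * (x + y) ≤ excess n k * T := by
  obtain ⟨j, rfl⟩ := Nat.exists_eq_add_of_le (show k ≤ n by omega)
  rw [Nat.add_sub_cancel_left] at hx
  unfold excess
  split_ifs with h
  · have := (Nat.mul_le_mul_left x (show 9 ≤ j + 1 by omega)).trans hx
    have := (Nat.mul_le_mul_left y (show 9 ≤ k + 1 by omega)).trans hy
    omega
  · have := (Nat.mul_le_mul_left x (show 3 ≤ j + 1 by omega)).trans hx
    have := (Nat.mul_le_mul_left y (show 3 ≤ k + 1 by omega)).trans hy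
    rcases le_or_gt 9 k with h9 | h9
    · have := (Nat.mul_le_mul_left y (show 10 ≤ k + 1 by omega)).trans hy
      omega
    · have := (Nat.mul_le_mul_left x (show 10 ≤ j + 1 by omega)).trans hx
      omega

open scoped Nat in
theorem ButterflyFree.two_mul_sum_arcPairCount_le {n : ℕ} [NeZero n] (hn : 18 ≤ n)
    {F : Finset (Finset (Fin n))} (hB : ButterflyFree F) (hF : ∀ M ∈ F, 1 ≤ #M ∧ #M < n)
    {M : Finset (Fin n)} (hM : M ∈ middle F) :
    2 * (∑ A ∈ F with A ⊂ M, n.choose #A * ∑ σ, arcPairCount A M σ +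
      ∑ C ∈ F with M ⊂ C, n.choose #C * ∑ σ, arcPairCount M C σ) ≤
      excess n #M * (n * n !) := by
  obtain ⟨A, hA, hAM, hA'⟩ := hB.exists_filter_ssubset_eq hM
  obtain ⟨C, hC, hMC, hC'⟩ := hB.exists_filter_superset_eq hM
  have h1 := card_lt_card hAM
  have h2 := card_lt_card hMC
  have h3 := hF A hA
  have h4 := hF C hC
  rw [hA', hC', sum_singleton, sum_singleton]
  exact two_mul_add_le_excess_mul hn (by omega) (by omega)
    (choose_mul_sum_arcPairCount_le hAM h3.1 (by omega))
    (choose_mul_sum_arcPairCount_le_of_lt hMC (by omega) h4.2)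

open scoped Nat in
theorem CycleBound.card_le {n K : ℕ} (hn : 18 ≤ n) (hK : CycleBound n (2 * (n * K)))
    {F : Finset (Finset (Fin n))} (hI : Intersecting F) (hB : ButterflyFree F)
    (hF : ∀ M ∈ F, 1 ≤ #M ∧ #M < n) : #F ≤ K := by
  have : NeZero n := ⟨by omega⟩
  have h1 := sum_sum_map_arc_eq hF fun _ => 1
  have h2 := sum_sum_map_arc_eq (fun M hM => hF M (mem_middle.1 hM).1) (excess n) (G := middle F)
  have h3 := sum_le_sum fun σ (_ : σ ∈ (univ : Finset (ZMod n ≃ Fin n))) =>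
    hK.sum_choose_le hI hB σ
  have h4 := sum_le_sum fun M (hM : M ∈ middle F) => hB.two_mul_sum_arcPairCount_le hn hF hM
  have hcard : Fintype.card (ZMod n ≃ Fin n) = n ! := by
    rw [Fintype.card_equiv (Fintype.equivOfCardEq (by simp [ZMod.card])), ZMod.card]
  simp only [one_mul, sum_const, smul_eq_mul, mul_one] at h1
  simp only [sum_add_distrib, ← mul_sum, sum_const, card_univ, hcard, smul_eq_mul, h1, h2] at h3
  have h5 : ∑ σ : ZMod n ≃ Fin n, ∑ M ∈ middle F, ∑ A ∈ F with A ⊂ M,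
      n.choose #A * arcPairCount A M σ =
      ∑ M ∈ middle F, ∑ A ∈ F with A ⊂ M, n.choose #A * ∑ σ, arcPairCount A M σ := by
    rw [sum_comm]
    refine sum_congr rfl fun M _ => ?_
    rw [sum_comm]
    exact sum_congr rfl fun A _ => (mul_sum _ _ _).symm
  have h6 : ∑ σ : ZMod n ≃ Fin n, ∑ M ∈ middle F, ∑ C ∈ F with M ⊂ C,
      n.choose #C * arcPairCount M C σ =
      ∑ M ∈ middle F, ∑ C ∈ F with M ⊂ C, n.choose #C * ∑ σ, arcPairCount M C σ := by
    rw [sum_comm]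
    refine sum_congr rfl fun M _ => ?_
    rw [sum_comm]
    exact sum_congr rfl fun A _ => (mul_sum _ _ _).symm
  rw [h5, h6] at h3
  rw [← mul_sum, sum_add_distrib, ← sum_mul] at h4
  refine Nat.le_of_mul_le_mul_left ?_ (show 0 < 2 * (n * n !) by positivity)
  linarith

theorem cycleBound_sigmaI {n : ℕ} (hn : 18 ≤ n) : CycleBound n (2 * (n * SigmaI n 2)) := by
  intro Y₁ Y₂ h₁ h₂ hI
  rcases Nat.even_or_odd' n with ⟨m, rfl | rfl⟩
  · have hS : 2 * m * SigmaI (2 * m) 2 = m * (2 * m).choose m + 2 * m * (2 * m).choose (m + 1) +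
        (m - 2) * (2 * m).choose (m + 2) := by
      have e1 := Nat.add_one_mul_choose_eq (2 * m - 1) (m - 1)
      have e2 := Nat.add_one_mul_choose_eq (2 * m - 1) (m + 2)
      have e3 := Nat.choose_succ_right_eq (2 * m) (m + 2)
      rw [show 2 * m - 1 + 1 = 2 * m by omega] at e1 e2
      rw [show m - 1 + 1 = m by omega] at e1
      rw [show 2 * m - (m + 2) = m - 2 by omega] at e3
      rw [SigmaI, if_neg (by omega), show 2 * m / 2 = m by omega, show m + 2 - 1 = m + 1 by omega,
        Icc_self, sum_singleton, mul_add, mul_add, e1, e2, e3]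
      ring
    rw [hS]
    exact cycle_sum_le_of_even (by omega) h₁ h₂ hI
  · have hS : SigmaI (2 * m + 1) 2 = (2 * m + 1).choose (m + 1) + (2 * m + 1).choose (m + 2) := by
      rw [SigmaI, if_pos (by omega), show (2 * m + 1 + 1) / 2 = m + 1 by omega,
        show m + 1 + 2 - 1 = m + 2 by omega, sum_Icc_succ_top (by omega), Icc_self, sum_singleton]
    rw [hS]
    exact cycle_sum_le_of_odd (by omega) h₁ h₂ hI

theorem two_mul_add_one_le_sigmaI {n : ℕ} (hn : 18 ≤ n) : 2 * n + 1 ≤ SigmaI n 2 := by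
  have h : (n - 1).choose 2 ≤ SigmaI n 2 := by
    unfold SigmaI
    split_ifs with h
    · refine (Nat.choose_le_choose 2 (Nat.sub_le n 1)).trans ?_
      refine (choose_le_choose_of_le_half (j := (n + 1) / 2) (by omega) (by omega)).trans ?_
      exact single_le_sum (f := n.choose) (fun _ _ => Nat.zero_le _) (by simp)
    · exact (choose_le_choose_of_le_half (by omega) (by omega)).trans
        ((Nat.le_add_right _ _).trans (Nat.le_add_right _ _))
  have h2 : 2 * n + 1 ≤ (n - 1).choose 2 := by
    rw [Nat.choose_two_right, Nat.le_div_iff_mul_le two_pos]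
    have := Nat.mul_le_mul_left (n - 1) (show 16 ≤ n - 1 - 1 by omega)
    omega
  exact h2.trans h

theorem ButterflyFree.card_le_of_univ_mem {n : ℕ} (hn : n ≠ 0) {F : Finset (Finset (Fin n))}
    (hI : Intersecting F) (hB : ButterflyFree F) (hu : univ ∈ F)
    (h : ∀ x, {x} ∈ F ∨ {x}ᶜ ∈ F) : #F ≤ 2 * n + 1 := by
  set coatoms : Finset (Finset (Fin n)) := univ.image fun x => {x}ᶜ with hc
  set R := F \ ({univ} ∪ coatoms) with hR
  have hex : ∀ B : Finset (Fin n), ∃ x, B ∈ R → x ∉ B ∧ {x}ᶜ ∈ F := fun B => by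
    by_cases hBR : B ∈ R
    · simp only [hR, hc, mem_sdiff, mem_union, mem_singleton, mem_image, mem_univ, true_and,
        not_or, not_exists] at hBR
      obtain ⟨-, hne, hco⟩ := hBR
      obtain ⟨x, hx⟩ : ∃ x, x ∉ B := by
        by_contra! hall
        exact hne (eq_univ_of_forall hall)
      obtain ⟨y, hy, hxy⟩ : ∃ y, y ∉ B ∧ y ≠ x := by
        by_contra! hall
        refine hco x (Finset.ext fun y => ?_)
        rw [mem_compl, mem_singleton]
        exact ⟨fun hyx => by_contra fun hyB => hyx (hall y hyB), fun hyB hyx => hx (hyx ▸ hyB)⟩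
      rcases h x with hx' | hx'
      · rcases h y with hy' | hy'
        · have := hI _ hx' _ hy'
          simp [hxy.symm] at this
        · exact ⟨y, fun _ => ⟨hy, hy'⟩⟩
      · exact ⟨x, fun _ => ⟨hx, hx'⟩⟩
    · exact ⟨⟨0, Nat.pos_of_ne_zero hn⟩, fun hB => (hBR hB).elim⟩
  choose f hf using hex
  have hRn : #R ≤ n := by
    refine le_of_le_of_eq ?_ (card_fin n)
    refine card_le_card_of_injOn f (fun _ _ => mem_coe.2 (mem_univ _)) fun B hBR B' hBR' heq => ?_
    by_contra hne
    have hlt : ∀ B ∈ R, B ⊂ {f B}ᶜ ∧ B ⊂ univ := fun B hBR => by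
      simp only [hR, hc, mem_sdiff, mem_union, mem_singleton, mem_image, mem_univ, true_and,
        not_or, not_exists] at hf hBR
      refine ⟨ssubset_of_subset_of_ne ?_ fun he => hBR.2.2 (f B) he.symm,
        ssubset_univ_iff.2 hBR.2.1⟩
      rw [subset_compl_singleton]
      exact (hf B hBR).1
    have h1 := hlt B hBR
    have h2 := hlt B' hBR'
    rw [← heq] at h2
    refine hB.false_of_ssubset (mem_sdiff.1 hBR).1 (mem_sdiff.1 hBR').1 (hf B hBR).2 hu hne ?_
      h1.1 h1.2 h2.1 h2.2
    simp
  have hcn : #coatoms ≤ n := card_image_le.trans_eq (by simp)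
  calc #F ≤ #(({univ} ∪ coatoms) ∪ R) := card_le_card fun B hBF => by
        rw [hR, union_sdiff_self_eq_union]
        exact mem_union_right _ hBF
    _ ≤ #({univ} : Finset (Finset (Fin n))) + #coatoms + #R :=
        (card_union_le _ _).trans (Nat.add_le_add_right (card_union_le _ _) _)
    _ ≤ _ := by
        rw [card_singleton]
        omega

theorem Intersecting.nonempty {α : Type*} [DecidableEq α] {F : Finset (Finset α)}
    (hI : Intersecting F) {A : Finset α} (hA : A ∈ F) : A.Nonempty := by
  simpa using hI A hA A hA

theorem Intersecting.insert_compl_singleton {n : ℕ} (hn : 2 ≤ n) {F : Finset (Finset (Fin n))}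
    (hI : Intersecting F) {x : Fin n} (hx : {x} ∉ F) :
    Intersecting (insert {x}ᶜ (F.erase univ)) := by
  have h : ∀ A ∈ F, (A ∩ {x}ᶜ).Nonempty := fun A hA => by
    by_contra hem
    rw [not_nonempty_iff_eq_empty, ← disjoint_iff_inter_eq_empty, disjoint_compl_right_iff,
      subset_singleton_iff] at hem
    rcases hem with rfl | rfl
    · exact not_nonempty_empty (hI.nonempty hA)
    · exact hx hA
  have hself : ({x}ᶜ ∩ {x}ᶜ : Finset (Fin n)).Nonempty := by
    rw [inter_self, ← card_pos, card_compl]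
    simp
    omega
  intro A hA B hB
  rw [mem_insert] at hA hB
  rcases hA with rfl | hA
  · rcases hB with rfl | hB
    · exact hself
    · rw [inter_comm]
      exact h B (mem_of_mem_erase hB)
  · rcases hB with rfl | hB
    · exact h A (mem_of_mem_erase hA)
    · exact hI A (mem_of_mem_erase hA) B (mem_of_mem_erase hB)

theorem ButterflyFree.insert_compl_singleton {n : ℕ} {F : Finset (Finset (Fin n))}
    (hB : ButterflyFree F) (hu : univ ∈ F) (x : Fin n) :
    ButterflyFree (insert {x}ᶜ (F.erase univ)) := by
  rintro ⟨A, B, C, D, hA, hB', hC, hD, hAB, hAC, hAD, hBC, hBD, hCD, sAC, sAD, sBC, sBD⟩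
  have hnu : ∀ {A}, A ∈ insert {x}ᶜ (F.erase univ) → A ≠ univ := fun {A} hA => by
    rcases mem_insert.1 hA with rfl | hA
    · simp
    · exact ne_of_mem_erase hA
  have hmax : ∀ {A C}, A ∈ insert {x}ᶜ (F.erase univ) → C ∈ insert {x}ᶜ (F.erase univ) →
      A ≠ C → A ⊆ C → A ∈ F := fun {A C} hA hC hne hsub => by
    rcases mem_insert.1 hA with rfl | hA
    · refine (hnu hC (eq_univ_of_forall fun y => ?_)).elim
      by_cases hy : y = x
      · subst hy
        by_contra hyC
        refine hne (hsub.antisymm ?_)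
        simpa [subset_compl_singleton] using hyC
      · exact hsub (by simpa using hy)
    · exact mem_of_mem_erase hA
  have hAF := hmax hA hC hAC sAC
  have hBF := hmax hB' hC hBC sBC
  have hA' := hnu hA
  have hB'' := hnu hB'
  rcases mem_insert.1 hC with rfl | hC
  · have hDF := (mem_erase.1 ((mem_insert.1 hD).resolve_left hCD.symm))
    exact hB ⟨A, B, univ, D, hAF, hBF, hu, hDF.2, hAB, hA', hAD, hB'', hBD, hDF.1.symm,
      subset_univ _, sAD, subset_univ _, sBD⟩
  · have hCF := mem_erase.1 hC
    rcases mem_insert.1 hD with rfl | hD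
    · exact hB ⟨A, B, C, univ, hAF, hBF, hCF.2, hu, hAB, hAC, hA', hBC, hB'', hCF.1,
        sAC, subset_univ _, sBC, subset_univ _⟩
    · exact hB ⟨A, B, C, D, hAF, hBF, hCF.2, mem_of_mem_erase hD, hAB, hAC, hAD, hBC, hBD, hCD,
        sAC, sAD, sBC, sBD⟩

theorem ButterflyFree.card_le_of_univ_notMem {n : ℕ} (hn : 18 ≤ n) {F : Finset (Finset (Fin n))}
    (hI : Intersecting F) (hB : ButterflyFree F) (hu : univ ∉ F) : #F ≤ SigmaI n 2 := by
  refine (cycleBound_sigmaI hn).card_le hn hI hB fun M hM => ⟨(hI.nonempty hM).card_pos, ?_⟩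
  refine lt_of_lt_of_eq ((card_lt_iff_ne_univ M).2 ?_) (Fintype.card_fin n)
  rintro rfl
  exact hu hM

theorem intersecting_butterflyFree_card_le (n : ℕ) (hn : 18 ≤ n)
    (F : Finset (Finset (Fin n))) (hF : Intersecting F) (hB : ButterflyFree F) :
    F.card ≤ SigmaI n 2 := by
  by_cases hu : univ ∈ F
  · by_cases h : ∀ x, {x} ∈ F ∨ {x}ᶜ ∈ F
    · exact (hB.card_le_of_univ_mem (by omega) hF hu h).trans (two_mul_add_one_le_sigmaI hn)
    · push Not at h
      obtain ⟨x, hx, hx'⟩ := h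
      have hcard : #(insert {x}ᶜ (F.erase univ)) = #F := by
        rw [card_insert_of_notMem fun h => hx' (mem_of_mem_erase h), card_erase_add_one hu]
      rw [← hcard]
      refine (hB.insert_compl_singleton hu x).card_le_of_univ_notMem hn
        (hF.insert_compl_singleton (by omega) hx) fun h => ?_
      have := (mem_insert.1 h).resolve_right (notMem_erase _ _)
      simpa using this.symm
  · exact hB.card_le_of_univ_notMem hn hF hu
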